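/- arXiv:alg-geom/9402003 — 2 statements merged into one kernel-verified Lean document; each statement's English description precedes it below -/
import Mathlib

section
/- For every integer g ≥ 1, S(2g) = (1/6) · ∫₀¹ b(x)³ dx, where b : ℝ → ℝ is given by b(x) = (-1)^{g+1} · (2π)^{2g} · B_{2g}(x) / (2g)! (equivalently b(x) = -(2πi)^{2g} B_{2g}(x)/(2g)!), and B_{2g} is the 2g-th Bernoulli polynomial. -/
open Finset intervalIntegral

/-- The multiple zeta value `S(m) = Σ_{i,j≥1} (i·j·(i+j))^{-m}`. -/
noncomputable def mzvS (m : ℤ) : ℝ :=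
  ∑' (i : ℕ) (j : ℕ),
    (((i : ℝ) + 1) * ((j : ℝ) + 1) * ((i : ℝ) + (j : ℝ) + 2)) ^ (-m)

lemma aux_int (n : ℤ) : ∫ x in (0:ℝ)..1, Real.cos (2 * Real.pi * n * x) = if n = 0 then 1 else 0 := by
  split_ifs with h
  · simp [h]
  · have hn : (2 * Real.pi * n : ℝ) ≠ 0 := by
      have : (n : ℝ) ≠ 0 := by exact_mod_cast h
      positivity
    rw [intervalIntegral.integral_comp_mul_left (fun y => Real.cos y) hn, integral_cos]
    have : Real.sin (2 * Real.pi * n * 1) = 0 := by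
      rw [Real.sin_eq_zero_iff]
      exact ⟨2 * n, by push_cast; ring⟩
    rw [this]; simp

lemma aux_int3 (a b c : ℕ) :
    ∫ x in (0:ℝ)..1, (Real.cos (2 * Real.pi * (a + 1 : ℕ) * x) * Real.cos (2 * Real.pi * (b + 1 : ℕ) * x))
      * Real.cos (2 * Real.pi * (c + 1 : ℕ) * x) =
    (1/4) * ((if a = b + c + 1 then 1 else 0) + (if b = a + c + 1 then 1 else 0)
      + (if c = a + b + 1 then 1 else 0)) := by
  have key : ∀ x : ℝ, (Real.cos (2 * Real.pi * (a + 1 : ℕ) * x) * Real.cos (2 * Real.pi * (b + 1 : ℕ) * x))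
      * Real.cos (2 * Real.pi * (c + 1 : ℕ) * x) =
      (1/4) * (((Real.cos (2 * Real.pi * ((a + b + c + 3 : ℤ)) * x)
        + Real.cos (2 * Real.pi * ((b + c + 1 - a : ℤ)) * x))
        + Real.cos (2 * Real.pi * ((a + c + 1 - b : ℤ)) * x))
        + Real.cos (2 * Real.pi * ((a + b + 1 - c : ℤ)) * x)) := by
    intro x
    set A := 2 * Real.pi * (a + 1 : ℕ) * x with hA
    set B := 2 * Real.pi * (b + 1 : ℕ) * x with hB
    set C := 2 * Real.pi * (c + 1 : ℕ) * x with hC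
    have e1 : 2 * Real.pi * ((a + b + c + 3 : ℤ)) * x = A + B + C := by
      rw [hA, hB, hC]; push_cast; ring
    have e2 : 2 * Real.pi * ((b + c + 1 - a : ℤ)) * x = B + C - A := by
      rw [hA, hB, hC]; push_cast; ring
    have e3 : 2 * Real.pi * ((a + c + 1 - b : ℤ)) * x = A + C - B := by
      rw [hA, hB, hC]; push_cast; ring
    have e4 : 2 * Real.pi * ((a + b + 1 - c : ℤ)) * x = A + B - C := by
      rw [hA, hB, hC]; push_cast; ring
    rw [e1, e2, e3, e4]
    simp only [Real.cos_add, Real.cos_sub, Real.sin_add]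
    ring
  have ii : ∀ n : ℤ, IntervalIntegrable (fun x : ℝ => Real.cos (2 * Real.pi * n * x))
      MeasureTheory.volume 0 1 := fun n => Continuous.intervalIntegrable (by fun_prop) _ _
  simp_rw [key]
  rw [intervalIntegral.integral_const_mul, intervalIntegral.integral_add (((ii _).add (ii _)).add (ii _)) (ii _),
    intervalIntegral.integral_add ((ii _).add (ii _)) (ii _),
    intervalIntegral.integral_add (ii _) (ii _), aux_int, aux_int, aux_int, aux_int]
  have h0 : ((a:ℤ) + b + c + 3 = 0) ↔ False := by constructor <;> [omega; simp]
  have h1 : ((b:ℤ) + c + 1 - a = 0) ↔ a = b + c + 1 := by omega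
  have h2 : ((a:ℤ) + c + 1 - b = 0) ↔ b = a + c + 1 := by omega
  have h3 : ((a:ℤ) + b + 1 - c = 0) ↔ c = a + b + 1 := by omega
  simp only [h0, h1, h2, h3, if_false, zero_add]

lemma aux_sum (g : ℕ) (hg : 1 ≤ g) (x : ℝ) (hx : x ∈ Set.Icc (0:ℝ) 1) :
    HasSum (fun n : ℕ => 1 / ((n + 1 : ℕ) : ℝ) ^ (2 * g) * Real.cos (2 * Real.pi * (n + 1 : ℕ) * x))
      (((-1 : ℝ) ^ (g + 1) * (2 * Real.pi) ^ (2 * g) *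
          Polynomial.aeval x (Polynomial.bernoulli (2 * g)) /
            (Nat.factorial (2 * g) : ℝ)) / 2) := by
  have h := hasSum_one_div_nat_pow_mul_cos (k := g) (by omega) hx
  rw [← hasSum_nat_add_iff' 1] at h
  have h2 : 2 * g ≠ 0 := by omega
  rw [Polynomial.eval_map_algebraMap] at h
  simp only [Finset.sum_range_one, Nat.cast_zero, zero_pow h2, div_zero, zero_mul, sub_zero] at h
  have e : ((-1 : ℝ) ^ (g + 1) * (2 * Real.pi) ^ (2 * g) *
          Polynomial.aeval x (Polynomial.bernoulli (2 * g)) /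
            (Nat.factorial (2 * g) : ℝ)) / 2 =
      (-1 : ℝ) ^ (g + 1) * (2 * Real.pi) ^ (2 * g) / 2 / (Nat.factorial (2 * g) : ℝ) *
      Polynomial.aeval x (Polynomial.bernoulli (2 * g)) := by ring
  rw [e]
  exact h

noncomputable def auxW (g : ℕ) (p : (ℕ × ℕ) × ℕ) : ℝ :=
  1 / ((p.1.1 + 1 : ℕ) : ℝ) ^ (2 * g) * (1 / ((p.1.2 + 1 : ℕ) : ℝ) ^ (2 * g)) *
    (1 / ((p.2 + 1 : ℕ) : ℝ) ^ (2 * g))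

lemma aux_w (g : ℕ) (hg : 1 ≤ g) : Summable (fun n : ℕ => 1 / ((n + 1 : ℕ) : ℝ) ^ (2 * g)) := by
  have h : Summable (fun n : ℕ => 1 / (n : ℝ) ^ (2 * g)) :=
    Real.summable_one_div_nat_pow.mpr (by omega)
  exact (summable_nat_add_iff 1).mpr h

lemma auxW_nonneg (g : ℕ) (p) : 0 ≤ auxW g p := by unfold auxW; positivity

lemma auxW_summable (g : ℕ) (hg : 1 ≤ g) : Summable (auxW g) := by
  have h := aux_w g hg
  have h2 := h.mul_of_nonneg h (fun n => by positivity) (fun n => by positivity)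
  exact h2.mul_of_nonneg h (fun n => by simp only [Pi.zero_apply]; positivity) (fun n => by positivity)

/-- Terms of the cube. -/
noncomputable def auxU (g : ℕ) (p : (ℕ × ℕ) × ℕ) (x : ℝ) : ℝ :=
  auxW g p * ((Real.cos (2 * Real.pi * (p.1.1 + 1 : ℕ) * x) *
    Real.cos (2 * Real.pi * (p.1.2 + 1 : ℕ) * x)) * Real.cos (2 * Real.pi * (p.2 + 1 : ℕ) * x))

lemma auxU_bound (g : ℕ) (p) (x : ℝ) : ‖auxU g p x‖ ≤ auxW g p := by
  unfold auxU
  rw [norm_mul, norm_mul, norm_mul, Real.norm_of_nonneg (auxW_nonneg g p)]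
  refine mul_le_of_le_one_right (auxW_nonneg g p) ?_
  exact mul_le_one₀ (mul_le_one₀ (Real.abs_cos_le_one _) (norm_nonneg _) (Real.abs_cos_le_one _))
    (norm_nonneg _) (Real.abs_cos_le_one _)

lemma aux_cube (f : ℕ → ℝ) (B : ℝ) (h : HasSum f B) :
    HasSum (fun p : (ℕ × ℕ) × ℕ => f p.1.1 * f p.1.2 * f p.2) (B ^ 3) := by
  have hs := h.summable.norm
  have h2 := h.mul h (summable_mul_of_summable_norm hs hs)
  have h3 := h2.mul h (summable_mul_of_summable_norm h2.summable.norm hs)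
  rw [pow_three']
  exact h3

lemma auxU_hasSum (g : ℕ) (hg : 1 ≤ g) (x : ℝ) (hx : x ∈ Set.Icc (0:ℝ) 1) :
    HasSum (fun p => auxU g p x) ((((-1 : ℝ) ^ (g + 1) * (2 * Real.pi) ^ (2 * g) *
          Polynomial.aeval x (Polynomial.bernoulli (2 * g)) /
            (Nat.factorial (2 * g) : ℝ)) / 2) ^ 3) := by
  have h := aux_cube _ _ (aux_sum g hg x hx)
  have e : (fun p => auxU g p x) = (fun p : (ℕ × ℕ) × ℕ =>
      (1 / ((p.1.1 + 1 : ℕ) : ℝ) ^ (2 * g) * Real.cos (2 * Real.pi * (p.1.1 + 1 : ℕ) * x)) *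
      (1 / ((p.1.2 + 1 : ℕ) : ℝ) ^ (2 * g) * Real.cos (2 * Real.pi * (p.1.2 + 1 : ℕ) * x)) *
      (1 / ((p.2 + 1 : ℕ) : ℝ) ^ (2 * g) * Real.cos (2 * Real.pi * (p.2 + 1 : ℕ) * x))) := by
    funext p
    unfold auxU auxW
    generalize 1 / ((p.1.1 + 1 : ℕ) : ℝ) ^ (2 * g) = A
    generalize 1 / ((p.1.2 + 1 : ℕ) : ℝ) ^ (2 * g) = B
    generalize 1 / ((p.2 + 1 : ℕ) : ℝ) ^ (2 * g) = C
    ring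
  rw [e]
  exact h

lemma aux_main (g : ℕ) (hg : 1 ≤ g) :
    HasSum (fun p => ∫ x in (0:ℝ)..1, auxU g p x)
      (∫ x in (0:ℝ)..1, (((-1 : ℝ) ^ (g + 1) * (2 * Real.pi) ^ (2 * g) *
          Polynomial.aeval x (Polynomial.bernoulli (2 * g)) /
            (Nat.factorial (2 * g) : ℝ)) / 2) ^ 3) := by
  refine intervalIntegral.hasSum_integral_of_dominated_convergence (fun p _ => auxW g p) ?_ ?_ ?_ ?_ ?_
  · intro p
    refine Continuous.aestronglyMeasurable ?_
    unfold auxU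
    fun_prop
  · exact fun p => Filter.Eventually.of_forall fun x _ => auxU_bound g p x
  · exact Filter.Eventually.of_forall fun x _ => auxW_summable g hg
  · exact intervalIntegrable_const
  · refine Filter.Eventually.of_forall fun x hx => auxU_hasSum g hg x ?_
    rw [Set.uIoc_of_le zero_le_one] at hx
    exact Set.Ioc_subset_Icc_self hx

/-- Summand of the double series. -/
noncomputable def auxT (g : ℕ) (q : ℕ × ℕ) : ℝ :=
  (((q.1 : ℝ) + 1) * ((q.2 : ℝ) + 1) * ((q.1 : ℝ) + (q.2 : ℝ) + 2)) ^ (-(2 * (g : ℤ)))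

lemma auxT_eq (g : ℕ) (q : ℕ × ℕ) : auxT g q =
    1 / ((q.1 + 1 : ℕ) : ℝ) ^ (2 * g) * (1 / ((q.2 + 1 : ℕ) : ℝ) ^ (2 * g)) *
    (1 / ((q.1 + q.2 + 1 + 1 : ℕ) : ℝ) ^ (2 * g)) := by
  unfold auxT
  have : (2 * (g : ℤ)) = ((2 * g : ℕ) : ℤ) := by push_cast; ring
  rw [this, zpow_neg, zpow_natCast, mul_pow, mul_pow, mul_inv, mul_inv]
  push_cast
  simp only [one_div]
  have e : (q.1 : ℝ) + q.2 + 1 + 1 = q.1 + q.2 + 2 := by ring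
  rw [e]

lemma auxT_summable (g : ℕ) (hg : 1 ≤ g) : Summable (auxT g) := by
  have hi : Function.Injective (fun q : ℕ × ℕ => (q, q.1 + q.2 + 1)) := by
    intro a b h; exact (Prod.ext_iff.mp h).1
  refine ((auxW_summable g hg).comp_injective hi).congr ?_
  intro q
  rw [auxT_eq]
  simp [auxW]

lemma auxT_tsum (g : ℕ) (hg : 1 ≤ g) : mzvS (2 * g) = ∑' q, auxT g q := by
  rw [(auxT_summable g hg).tsum_prod]
  rfl

lemma aux_part (g : ℕ) (hg : 1 ≤ g) (P : (ℕ × ℕ) × ℕ → Prop) [DecidablePred P]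
    (e : ℕ × ℕ → (ℕ × ℕ) × ℕ) (he : Function.Injective e) (hP : ∀ p, P p ↔ p ∈ Set.range e)
    (hW : ∀ q, auxW g (e q) = auxT g q) :
    HasSum (fun p => auxW g p * (if P p then 1 else 0)) (mzvS (2 * g)) := by
  rw [auxT_tsum g hg, ← he.hasSum_iff]
  · refine (auxT_summable g hg).hasSum.congr_fun ?_
    intro q
    have : P (e q) := (hP _).2 ⟨q, rfl⟩
    simp [this, hW]
  · intro p hp
    rw [← hP] at hp
    simp [hp]

theorem mzvS_bernoulli (g : ℕ) (hg : 1 ≤ g) :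
    mzvS (2 * g) =
      (1 / 6) * ∫ x in (0 : ℝ)..1,
        ((-1 : ℝ) ^ (g + 1) * (2 * Real.pi) ^ (2 * g) *
          Polynomial.aeval x (Polynomial.bernoulli (2 * g)) /
            (Nat.factorial (2 * g) : ℝ)) ^ 3 := by
  have h1 := aux_part g hg (fun p => p.1.1 = p.1.2 + p.2 + 1)
    (fun q => ((q.1 + q.2 + 1, q.1), q.2)) (by
      rintro ⟨a, b⟩ ⟨c, d⟩ h
      simp only [Prod.mk.injEq] at h ⊢; omega) (by
      rintro ⟨⟨a, b⟩, c⟩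
      simp only [Set.mem_range, Prod.mk.injEq, Prod.exists]
      constructor
      · intro h; exact ⟨b, c, by omega⟩
      · rintro ⟨i, j, h⟩; omega) (by
      intro q; rw [auxT_eq]; simp only [auxW]; ring)
  have h2 := aux_part g hg (fun p => p.1.2 = p.1.1 + p.2 + 1)
    (fun q => ((q.1, q.1 + q.2 + 1), q.2)) (by
      rintro ⟨a, b⟩ ⟨c, d⟩ h
      simp only [Prod.mk.injEq] at h ⊢; omega) (by
      rintro ⟨⟨a, b⟩, c⟩
      simp only [Set.mem_range, Prod.mk.injEq, Prod.exists]
      constructor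
      · intro h; exact ⟨a, c, by omega⟩
      · rintro ⟨i, j, h⟩; omega) (by
      intro q; rw [auxT_eq]; simp only [auxW]; ring)
  have h3 := aux_part g hg (fun p => p.2 = p.1.1 + p.1.2 + 1)
    (fun q => ((q.1, q.2), q.1 + q.2 + 1)) (by
      rintro ⟨a, b⟩ ⟨c, d⟩ h
      simp only [Prod.mk.injEq] at h ⊢; omega) (by
      rintro ⟨⟨a, b⟩, c⟩
      simp only [Set.mem_range, Prod.mk.injEq, Prod.exists]
      constructor
      · intro h; exact ⟨a, b, by omega⟩
      · rintro ⟨i, j, h⟩; omega) (by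
      intro q; rw [auxT_eq]; rfl)
  have hsum := ((h1.add h2).add h3).mul_left (1 / 4)
  have hm := aux_main g hg
  have heq := hm.unique (hsum.congr_fun (by
    intro p
    simp only [auxU]
    rw [intervalIntegral.integral_const_mul, aux_int3]
    ring))
  simp_rw [div_pow _ (2 : ℝ) 3] at heq
  rw [intervalIntegral.integral_div] at heq
  linarith
end

section
/- For every integer g ≥ 1 and all reals r₁, r₂ with 0 < r₁ < r₂ < 1: S(2g) = (1/3) · (2πi)^{-2} · ∮_{|y|=r₂} ( ∮_{|x|=r₁} π² cot(πx) cot(πy) · (x·y·(x+y))^{-2g} dx ) dy, where cot denotes the complex cotangent function. -/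
open Finset

/-- A point of the circle of radius `r < 1` is not an integer. -/
lemma mzv_sphere_mem {r : ℝ} (h0 : 0 < r) (h1 : r < 1) {x : ℂ} (hx : ‖x‖ = r) :
    x ∈ Complex.integerComplement := by
  rintro ⟨n, rfl⟩
  rw [Complex.norm_intCast] at hx
  rcases eq_or_ne n 0 with rfl | hn
  · simp at hx; linarith
  · have : (1 : ℝ) ≤ |(n : ℝ)| := by exact_mod_cast Int.one_le_abs hn
    linarith

lemma mzv_cotTerm_bound {r : ℝ} (h0 : 0 < r) (h1 : r < 1) {x : ℂ} (hx : ‖x‖ = r) (n : ℕ) :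
    ‖cotTerm x n‖ ≤ 2 / (1 - r) ^ 2 * (1 / ((n : ℝ) + 1) ^ 2) := by
  have hp : (0:ℝ) ≤ n := n.cast_nonneg
  rw [cotTerm_identity (mzv_sphere_mem h0 h1 hx)]
  have e : ‖((n : ℂ) + 1)‖ = n + 1 := by
    have := Complex.norm_natCast (n + 1); push_cast at this; exact this
  have a1 : (n : ℝ) + 1 - r ≤ ‖x + (n + 1)‖ := by
    have := norm_sub_norm_le ((n : ℂ) + 1) (-x)
    rw [norm_neg, e, hx] at this
    rwa [sub_neg_eq_add, add_comm _ x] at this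
  have a2 : (n : ℝ) + 1 - r ≤ ‖x - (n + 1)‖ := by
    have := norm_sub_norm_le ((n : ℂ) + 1) x
    rw [e, hx, norm_sub_rev] at this
    exact this
  have hA : 0 < (n : ℝ) + 1 - r := by linarith
  have a3 : (1 - r) * ((n : ℝ) + 1) ≤ n + 1 - r := by nlinarith
  have hB : 0 < (1 - r) * ((n : ℝ) + 1) := mul_pos (by linarith) (by linarith)
  have key : ((1 - r) * ((n : ℝ) + 1)) * ((1 - r) * ((n : ℝ) + 1)) ≤
      ‖x + (n + 1)‖ * ‖x - (n + 1)‖ := by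
    gcongr <;> linarith
  rw [norm_mul, norm_div, norm_mul, norm_mul, hx, norm_one]
  have e2 : 2 / (1 - r) ^ 2 * (1 / ((n : ℝ) + 1) ^ 2) =
      2 * (1 / (((1 - r) * ((n : ℝ) + 1)) * ((1 - r) * ((n : ℝ) + 1)))) := by
    have : 1 - r ≠ 0 := by linarith
    field_simp
  rw [e2]
  have : ‖(2:ℂ)‖ * r ≤ 2 := by rw [Complex.norm_two]; linarith
  gcongr

lemma mzv_hasSum_circle {r : ℝ} (h0 : 0 < r) (h1 : r < 1) {f : ℂ → ℂ}
    (hf : ContinuousOn f (Metric.sphere 0 r)) :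
    HasSum (fun n : ℕ => ∮ x in C(0, r), cotTerm x n * f x)
      (∮ x in C(0, r), ((Real.pi : ℂ) * Complex.cot (Real.pi * x) - 1 / x) * f x) := by
  obtain ⟨M, hM⟩ := (isCompact_sphere (0:ℂ) r).exists_bound_of_continuousOn hf
  have hmem : ∀ θ : ℝ, circleMap 0 r θ ∈ Metric.sphere (0:ℂ) r :=
    fun θ => circleMap_mem_sphere _ h0.le θ
  have hn : ∀ θ : ℝ, ‖circleMap 0 r θ‖ = r := fun θ => by simpa using hmem θ
  have hM0 : 0 ≤ M := (norm_nonneg _).trans (hM _ (hmem 0))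
  have hs : Summable (fun n : ℕ => r * (2 / (1 - r) ^ 2 * (1 / ((n : ℝ) + 1) ^ 2) * M)) := by
    apply Summable.mul_left
    apply Summable.mul_right
    apply Summable.mul_left
    have := (summable_nat_add_iff 1).2 (Real.summable_one_div_nat_pow.2 (one_lt_two))
    simpa using this
  unfold circleIntegral
  apply intervalIntegral.hasSum_integral_of_dominated_convergence
    (F := fun (n : ℕ) (θ : ℝ) => deriv (circleMap 0 r) θ •
      (cotTerm (circleMap 0 r θ) n * f (circleMap 0 r θ)))
    (fun (n : ℕ) _ => r * (2 / (1 - r) ^ 2 * (1 / ((n : ℝ) + 1) ^ 2) * M))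
  · intro n
    apply Continuous.aestronglyMeasurable
    have hfc : Continuous (fun θ => f (circleMap 0 r θ)) :=
      hf.comp_continuous (continuous_circleMap 0 r) hmem
    have hd : Continuous (fun θ => cotTerm (circleMap 0 r θ) n) := by
      unfold cotTerm
      have c := continuous_circleMap 0 r
      refine Continuous.add (continuous_const.div (c.sub continuous_const) ?_)
        (continuous_const.div (c.add continuous_const) ?_)
      · intro θ
        simpa [sub_eq_add_neg] using Complex.integerComplement_add_ne_zero
          (mzv_sphere_mem h0 h1 (hn θ)) (-(n + 1) : ℤ)
      · intro θ
        simpa using Complex.integerComplement_add_ne_zero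
          (mzv_sphere_mem h0 h1 (hn θ)) ((n : ℤ) + 1)
    simp only [deriv_circleMap, smul_eq_mul]
    exact ((continuous_circleMap 0 r).mul continuous_const).mul (hd.mul hfc)
  · intro n
    filter_upwards with θ _
    simp only [deriv_circleMap, smul_eq_mul, norm_mul, Complex.norm_I, mul_one, hn]
    have := mzv_cotTerm_bound h0 h1 (hn θ) n
    have := hM _ (hmem θ)
    gcongr
  · filter_upwards with θ _ using hs
  · exact intervalIntegrable_const
  · filter_upwards with θ _
    have hx := mzv_sphere_mem h0 h1 (hn θ)
    apply HasSum.const_smul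
    apply HasSum.mul_right
    rw [cot_series_rep' hx]
    exact (summable_cotTerm hx).hasSum

lemma mzv_inv_pow_integral (r : ℝ) (p : ℕ) :
    (∮ x in C(0, r), (x⁻¹) ^ (p + 2) : ℂ) = 0 := by
  have := circleIntegral.integral_sub_zpow_of_ne (n := -((p:ℤ) + 2)) (by omega) 0 0 r
  rw [← this]
  congr 1
  funext x
  rw [sub_zero, inv_pow, zpow_neg]
  norm_cast

lemma mzv_simple_pole {r : ℝ} (h0 : 0 < r) {a : ℂ} (ha : r < ‖a‖) (p : ℕ) :
    (∮ x in C(0, r), (x - a)⁻¹ * (x⁻¹) ^ (p + 1) : ℂ) =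
      -(2 * Real.pi * Complex.I) * (a⁻¹) ^ (p + 1) := by
  have ha0 : a ≠ 0 := by rintro rfl; simp at ha; linarith
  have hne : ∀ x ∈ Metric.closedBall (0:ℂ) r, x - a ≠ 0 := by
    intro x hx h
    rw [sub_eq_zero] at h
    subst h
    simp at hx; linarith
  have hne' : ∀ x ∈ Metric.sphere (0:ℂ) r, x - a ≠ 0 :=
    fun x hx => hne x (Metric.sphere_subset_closedBall hx)
  have hx0 : ∀ x ∈ Metric.sphere (0:ℂ) r, x ≠ 0 := by
    rintro x hx rfl; simp at hx; linarith
  have hc1 : ∀ q : ℕ, CircleIntegrable (fun x => (x - a)⁻¹ * (x⁻¹) ^ q) 0 r := by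
    intro q
    apply ContinuousOn.circleIntegrable h0.le
    exact ((continuousOn_id.sub continuousOn_const).inv₀ hne').mul
      ((continuousOn_id.inv₀ hx0).pow q)
  have hc2 : ∀ q : ℕ, CircleIntegrable (fun x => (x⁻¹) ^ q : ℂ → ℂ) 0 r := by
    intro q
    apply ContinuousOn.circleIntegrable h0.le
    exact ((continuousOn_id.inv₀ hx0).pow q)
  have hrec : ∀ q : ℕ, (∮ x in C(0, r), (x - a)⁻¹ * (x⁻¹) ^ (q + 1) : ℂ) =
      a⁻¹ * ((∮ x in C(0, r), (x - a)⁻¹ * (x⁻¹) ^ q) - ∮ x in C(0, r), (x⁻¹) ^ (q + 1)) := by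
    intro q
    rw [← circleIntegral.integral_sub (hc1 q) (hc2 (q+1)), ← circleIntegral.integral_const_mul]
    apply circleIntegral.integral_congr h0.le
    intro x hx
    have := hne' x hx
    have := hx0 x hx
    simp only [inv_pow]
    field_simp
    ring
  induction p with
  | zero =>
    have z : (∮ x in C(0, r), (x - a)⁻¹ * (x⁻¹) ^ 0) = 0 := by
      apply DiffContOnCl.circleIntegral_eq_zero h0.le
      apply DifferentiableOn.diffContOnCl_ball (U := Metric.closedBall 0 r) _ subset_rfl
      simp only [pow_zero, mul_one]
      exact (differentiableOn_id.sub (differentiableOn_const _)).inv hne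
    have z2 := circleIntegral.integral_sub_center_inv 0 h0.ne'
    simp only [sub_zero] at z2
    rw [hrec, z]
    simp only [zero_add, pow_one, z2]
    ring
  | succ p ih =>
    rw [hrec, ih, mzv_inv_pow_integral r]
    ring

/-- `σ_p`, the symmetric sum of `n^{-p}` over the nonzero integers. -/
noncomputable def mzvSigma (p : ℕ) : ℂ :=
  ∑' n : ℕ, ((((n : ℂ) + 1)⁻¹) ^ p + ((-((n : ℂ) + 1))⁻¹) ^ p)

lemma mzv_cot_continuousOn {r : ℝ} (h0 : 0 < r) (h1 : r < 1) :
    ContinuousOn (fun x : ℂ => (Real.pi : ℂ) * Complex.cot (Real.pi * x)) (Metric.sphere 0 r) := by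
  unfold Complex.cot
  refine continuousOn_const.mul (ContinuousOn.div (by fun_prop) (by fun_prop) ?_)
  intro x hx
  exact sin_pi_mul_ne_zero (mzv_sphere_mem h0 h1 (by simpa using hx))

lemma mzv_cot_split {r : ℝ} (h0 : 0 < r) (h1 : r < 1) {f : ℂ → ℂ}
    (hf : ContinuousOn f (Metric.sphere 0 r)) :
    (∮ x in C(0, r), ((Real.pi : ℂ) * Complex.cot (Real.pi * x)) * f x) =
      (∮ x in C(0, r), x⁻¹ * f x) + ∑' n : ℕ, ∮ x in C(0, r), cotTerm x n * f x := by
  rw [(mzv_hasSum_circle h0 h1 hf).tsum_eq]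
  have hx0 : ∀ x ∈ Metric.sphere (0:ℂ) r, x ≠ 0 := by
    rintro x hx rfl; simp at hx; linarith
  have c1 : ContinuousOn (fun x : ℂ => x⁻¹) (Metric.sphere 0 r) := continuousOn_id.inv₀ hx0
  have c2 := mzv_cot_continuousOn h0 h1
  rw [← circleIntegral.integral_add (ContinuousOn.circleIntegrable h0.le (c1.fun_mul hf))]
  · congr 1
    funext x
    simp only [one_div]
    ring
  · simp only [one_div]
    exact ((c2.fun_sub c1).fun_mul hf).circleIntegrable h0.le

lemma mzv_natp (n : ℕ) : ‖((n : ℂ) + 1)‖ = n + 1 := by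
  have := Complex.norm_natCast (n + 1); push_cast at this; exact this

lemma mzv_cot_pow {r : ℝ} (h0 : 0 < r) (h1 : r < 1) (p : ℕ) :
    (∮ x in C(0, r), ((Real.pi : ℂ) * Complex.cot (Real.pi * x)) * (x⁻¹) ^ (p + 1)) =
      -(2 * Real.pi * Complex.I) * mzvSigma (p + 1) := by
  have hx0 : ∀ x ∈ Metric.sphere (0:ℂ) r, x ≠ 0 := by
    rintro x hx rfl; simp at hx; linarith
  have c1 : ContinuousOn (fun x : ℂ => x⁻¹) (Metric.sphere 0 r) := continuousOn_id.inv₀ hx0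
  rw [mzv_cot_split h0 h1 (c1.fun_pow (p + 1))]
  have e : (∮ x in C(0, r), x⁻¹ * (x⁻¹) ^ (p + 1) : ℂ) = 0 := by
    refine Eq.trans ?_ (mzv_inv_pow_integral r p)
    congr 1; funext x; ring
  rw [e, zero_add, mzvSigma, ← tsum_mul_left]
  congr 1
  funext n
  have hp : (0:ℝ) ≤ n := n.cast_nonneg
  have k1 := mzv_simple_pole h0 (a := (n : ℂ) + 1) (by rw [mzv_natp]; linarith) p
  have k2 := mzv_simple_pole h0 (a := -((n : ℂ) + 1))
    (by rw [norm_neg, mzv_natp]; linarith) p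
  rw [mul_add, ← k1, ← k2, ← circleIntegral.integral_add]
  · congr 1; funext x; unfold cotTerm; simp only [sub_neg_eq_add, one_div]; ring
  · apply ContinuousOn.circleIntegrable h0.le
    refine ((continuousOn_id.sub continuousOn_const).inv₀ ?_).mul (c1.pow _)
    intro x hx h
    replace h : x = (n : ℂ) + 1 := sub_eq_zero.1 h
    have := mzv_natp n
    rw [← h] at this
    simp at hx; linarith
  · apply ContinuousOn.circleIntegrable h0.le
    refine ((continuousOn_id.sub continuousOn_const).inv₀ ?_).mul (c1.pow _)
    intro x hx h
    replace h : x = -((n : ℂ) + 1) := sub_eq_zero.1 h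
    have := mzv_natp n
    rw [← norm_neg, ← h] at this
    simp at hx; linarith

lemma mzv_cot_shift {r : ℝ} (h0 : 0 < r) (h1 : r < 1) {y : ℂ} (hy : r < ‖y‖) (p : ℕ) :
    (∮ x in C(0, r), ((Real.pi : ℂ) * Complex.cot (Real.pi * x)) * ((x + y)⁻¹) ^ p) =
      (2 * Real.pi * Complex.I) * (y⁻¹) ^ p := by
  have hne : ∀ x ∈ Metric.closedBall (0:ℂ) r, x + y ≠ 0 := by
    intro x hx h
    rw [add_eq_zero_iff_eq_neg] at h
    subst h
    simp at hx; linarith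
  have d1 : DifferentiableOn ℂ (fun x : ℂ => ((x + y)⁻¹) ^ p) (Metric.closedBall 0 r) :=
    ((differentiableOn_id.add (differentiableOn_const _)).inv hne).pow p
  rw [mzv_cot_split h0 h1 (d1.continuousOn.mono Metric.sphere_subset_closedBall)]
  have z : ∀ n : ℕ, (∮ x in C(0, r), cotTerm x n * ((x + y)⁻¹) ^ p) = 0 := by
    intro n
    have hp : (0:ℝ) ≤ n := n.cast_nonneg
    apply DiffContOnCl.circleIntegral_eq_zero h0.le
    apply DifferentiableOn.diffContOnCl_ball (U := Metric.closedBall 0 r) _ subset_rfl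
    refine DifferentiableOn.mul ?_ d1
    unfold cotTerm
    refine ((differentiableOn_const _).div (differentiableOn_id.sub (differentiableOn_const _))
      ?_).add ((differentiableOn_const _).div (differentiableOn_id.add (differentiableOn_const _)) ?_)
    · intro x hx h
      rw [sub_eq_zero] at h
      have := mzv_natp n
      rw [← h] at this
      simp at hx; linarith
    · intro x hx h
      rw [add_eq_zero_iff_neg_eq] at h
      have := mzv_natp n
      rw [← h, norm_neg] at this
      simp at hx; linarith
  simp only [z, tsum_zero, add_zero]
  have := Complex.circleIntegral_sub_center_inv_smul_of_differentiable_on_off_countable h0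
    Set.countable_empty d1.continuousOn
    (fun z hz => (d1.differentiableAt
      (mem_nhds_iff.2 ⟨_, Metric.ball_subset_closedBall, Metric.isOpen_ball, hz.1⟩)))
  simpa using this


lemma mzv_sigma_parity (p : ℕ) : (-1) ^ p * mzvSigma p = mzvSigma p := by
  unfold mzvSigma
  rw [← tsum_mul_left]
  congr 1; funext n
  rw [inv_neg, neg_pow ((n : ℂ) + 1)⁻¹]
  have : ((-1 : ℂ) ^ p) * (-1) ^ p = 1 := by rw [← mul_pow]; simp
  linear_combination (((n : ℂ) + 1)⁻¹) ^ p * this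

lemma mzv_hasSum_sigma (p : ℕ) (hp : 2 ≤ p) :
    HasSum (fun n : ℤ => ((n : ℂ)⁻¹) ^ p) (mzvSigma p) := by
  have hs : Summable (fun n : ℕ => (((n : ℂ) + 1)⁻¹) ^ p) := by
    have := (summable_nat_add_iff 1).2 (Complex.summable_one_div_nat_cpow (p := p) |>.2
      (by simp; omega))
    simpa using this
  have hs2 : Summable (fun n : ℕ => ((-((n : ℂ) + 1))⁻¹) ^ p) := by
    refine (hs.mul_left ((-1) ^ p)).congr ?_
    intro n
    rw [inv_neg, neg_pow ((n : ℂ) + 1)⁻¹]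
  have h1 : HasSum (fun n : ℕ => (((n : ℤ) : ℂ)⁻¹) ^ p) (∑' n : ℕ, (((n : ℂ) + 1)⁻¹) ^ p) := by
    rw [← hasSum_nat_add_iff' 1]
    have : p ≠ 0 := by omega
    simpa [this] using hs.hasSum
  have h2 := h1.of_nat_of_neg_add_one (f := fun n : ℤ => ((n : ℂ)⁻¹) ^ p)
    (m' := ∑' n : ℕ, ((-((n : ℂ) + 1))⁻¹) ^ p) (by simpa using hs2.hasSum)
  rwa [← hs.tsum_add hs2] at h2

lemma mzv_tele_nat : HasSum (fun n : ℕ => ((n : ℂ)⁻¹ - ((n : ℂ) + 1)⁻¹)) 0 := by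
  have hr : HasSum (fun n : ℕ => (((n : ℝ) + 1)⁻¹ - ((n : ℝ) + 1 + 1)⁻¹)) 1 := by
    rw [hasSum_iff_tendsto_nat_of_nonneg]
    · have : ∀ N : ℕ, ∑ n ∈ range N, (((n : ℝ) + 1)⁻¹ - ((n : ℝ) + 1 + 1)⁻¹) =
          1 - ((N : ℝ) + 1)⁻¹ := by
        intro N
        induction N with
        | zero => simp
        | succ N ih => rw [sum_range_succ, ih]; push_cast; ring
      simp only [this]
      have h := tendsto_one_div_add_atTop_nhds_zero_nat (𝕜 := ℝ)
      simp only [one_div] at h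
      simpa using h.const_sub 1
    · intro n
      have : (0:ℝ) ≤ n := n.cast_nonneg
      rw [sub_nonneg]
      gcongr
      linarith
  rw [← hasSum_nat_add_iff' 1]
  have := Complex.hasSum_ofReal.2 hr
  simpa using this

lemma mzv_tele_one : HasSum (fun n : ℤ => ((n : ℂ)⁻¹ - ((n : ℂ) + 1)⁻¹)) 0 := by
  have := HasSum.of_nat_of_neg_add_one (f := fun n : ℤ => ((n : ℂ)⁻¹ - ((n : ℂ) + 1)⁻¹))
    (m := 0) (m' := 0) (by simpa using mzv_tele_nat) (by
      refine mzv_tele_nat.congr_fun fun n => ?_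
      push_cast
      rw [show (-((n : ℂ) + 1) + 1) = -n by ring, inv_neg, inv_neg]
      ring)
  simpa using this

lemma mzv_tele (j : ℤ) : HasSum (fun n : ℤ => ((n : ℂ)⁻¹ - ((n : ℂ) + j)⁻¹)) 0 := by
  have tr : ∀ k : ℤ, HasSum (fun n : ℤ => (((n : ℂ) + k)⁻¹ - ((n : ℂ) + k + 1)⁻¹)) 0 := by
    intro k
    have := (Equiv.addRight k).hasSum_iff.2 mzv_tele_one
    simpa [Function.comp_def] using this
  induction j with
  | zero => simp
  | succ k ih =>
    have := ih.add (tr k)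
    rw [add_zero] at this
    convert this using 2
    push_cast; ring
  | pred k ih =>
    have := ih.sub (tr (-(k : ℤ) - 1))
    rw [sub_zero] at this
    refine this.congr_fun fun n => ?_
    push_cast
    rw [show ((n : ℂ) + (-k - 1) + 1) = n + -k by ring]
    ring

lemma mzv_pair (p : ℕ) (j : ℤ) :
    HasSum (fun n : ℤ => ((n : ℂ)⁻¹) ^ (p + 1) + (-1) ^ (p + 1) * (((n : ℂ) + j)⁻¹) ^ (p + 1))
      (2 * mzvSigma (p + 1)) := by
  rcases p with _ | p
  · have h : mzvSigma 1 = 0 := by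
      have := mzv_sigma_parity 1
      linear_combination -(1/2 : ℂ) * this
    simp only [zero_add, h, mul_zero, pow_one, neg_mul, one_mul, ← sub_eq_add_neg]
    exact mzv_tele j
  · have h := mzv_hasSum_sigma (p + 1 + 1) (by omega)
    have h2 := (Equiv.addRight j).hasSum_iff.2 h
    have := h.add (h2.mul_left ((-1) ^ (p + 1 + 1)))
    rw [mzv_sigma_parity, ← two_mul] at this
    simpa [Function.comp_def] using this

/-- Partial fractions. -/
lemma mzv_pf (N : ℕ) : ∀ a b : ℕ, a + b = N + 1 → ∃ A B : ℕ → ℂ, ∀ x y : ℂ,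
    x ≠ 0 → y ≠ 0 → x + y ≠ 0 → (x⁻¹) ^ a * ((x + y)⁻¹) ^ b =
      ∑ k ∈ range (N + 1), (y⁻¹) ^ (N - k) *
        (A k * (x⁻¹) ^ (k + 1) + B k * ((x + y)⁻¹) ^ (k + 1)) := by
  induction N with
  | zero =>
    intro a b hab
    obtain ⟨rfl, rfl⟩ | ⟨rfl, rfl⟩ : (a = 0 ∧ b = 1) ∨ (a = 1 ∧ b = 0) := by omega
    · exact ⟨0, 1, fun x y _ _ _ => by simp⟩
    · exact ⟨1, 0, fun x y _ _ _ => by simp⟩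
  | succ N ih =>
    intro a b hab
    rcases a with _ | a
    · refine ⟨0, Pi.single (N + 1) 1, fun x y _ _ _ => ?_⟩
      obtain rfl : b = N + 1 + 1 := by omega
      rw [sum_range_succ, sum_eq_zero]
      · simp
      · intro k hk
        have : k ≠ N + 1 := by rw [mem_range] at hk; omega
        simp [this]
    rcases b with _ | b
    · refine ⟨Pi.single (N + 1) 1, 0, fun x y _ _ _ => ?_⟩
      obtain rfl : a = N + 1 := by omega
      rw [sum_range_succ, sum_eq_zero]
      · simp
      · intro k hk
        have : k ≠ N + 1 := by rw [mem_range] at hk; omega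
        simp [this]
    obtain ⟨A, B, h1⟩ := ih (a + 1) b (by omega)
    obtain ⟨A', B', h2⟩ := ih a (b + 1) (by omega)
    refine ⟨fun k => if k = N + 1 then 0 else A k - A' k,
      fun k => if k = N + 1 then 0 else B k - B' k, fun x y hx hy hxy => ?_⟩
    have e : (x⁻¹) ^ (a + 1) * ((x + y)⁻¹) ^ (b + 1) =
        y⁻¹ * ((x⁻¹) ^ (a + 1) * ((x + y)⁻¹) ^ b - (x⁻¹) ^ a * ((x + y)⁻¹) ^ (b + 1)) := by
      simp only [inv_pow]
      field_simp
      ring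
    rw [e, h1 x y hx hy hxy, h2 x y hx hy hxy, ← sum_sub_distrib, mul_sum,
      sum_range_succ _ (N + 1)]
    simp only [if_true, zero_mul, add_zero, mul_zero]
    apply sum_congr rfl
    intro k hk
    rw [mem_range] at hk
    have hk' : k ≠ N + 1 := by omega
    have : N + 1 - k = (N - k) + 1 := by omega
    simp only [hk', if_false]
    rw [this]
    ring

lemma mzv_pf_symm (m N : ℕ) (hm : Even m) (hN : m + m = N + 1) : ∃ D : ℕ → ℂ, ∀ x y : ℂ,
    x ≠ 0 → y ≠ 0 → x + y ≠ 0 → (x⁻¹) ^ m * ((x + y)⁻¹) ^ m =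
      ∑ k ∈ range (N + 1), (y⁻¹) ^ (N - k) * D k *
        ((x⁻¹) ^ (k + 1) + (-1) ^ (k + 1) * ((x + y)⁻¹) ^ (k + 1)) := by
  obtain ⟨A, B, h⟩ := mzv_pf N m m hN
  refine ⟨fun k => (A k + (-1) ^ (k + 1) * B k) / 2, fun x y hx hy hxy => ?_⟩
  have h1 := h x y hx hy hxy
  have h2 := h (-(x + y)) y (neg_ne_zero.2 hxy) hy (by simpa using hx)
  have e1 : -(x + y) + y = -x := by ring
  rw [e1, inv_neg, inv_neg, hm.neg_pow, hm.neg_pow, mul_comm] at h2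
  have : (x⁻¹) ^ m * ((x + y)⁻¹) ^ m = ((x⁻¹) ^ m * ((x + y)⁻¹) ^ m +
    (x⁻¹) ^ m * ((x + y)⁻¹) ^ m) / 2 := by ring
  rw [this]
  nth_rewrite 1 [h1]
  rw [h2, ← sum_add_distrib, sum_div]
  apply sum_congr rfl
  intro k _
  rw [neg_pow (x + y)⁻¹, neg_pow x⁻¹]
  have : ((-1 : ℂ) ^ (k + 1)) * (-1) ^ (k + 1) = 1 := by rw [← mul_pow]; simp
  linear_combination (-(1/2) * (y⁻¹) ^ (N - k) * B k * ((x + y)⁻¹) ^ (k + 1)) * this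

lemma mzv_T (m N : ℕ) (hN : m + m = N + 1) {D : ℕ → ℂ} (hD : ∀ x y : ℂ,
    x ≠ 0 → y ≠ 0 → x + y ≠ 0 → (x⁻¹) ^ m * ((x + y)⁻¹) ^ m =
      ∑ k ∈ range (N + 1), (y⁻¹) ^ (N - k) * D k *
        ((x⁻¹) ^ (k + 1) + (-1) ^ (k + 1) * ((x + y)⁻¹) ^ (k + 1))) (j : ℤ) (hj : j ≠ 0) :
    HasSum (fun n : ℤ => ((n : ℂ)⁻¹) ^ m * (((n : ℂ) + j)⁻¹) ^ m)
      (∑ k ∈ range (N + 1), ((j : ℂ)⁻¹) ^ (N - k) * D k *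
        (2 * mzvSigma (k + 1) - 2 * (-1) ^ (k + 1) * ((j : ℂ)⁻¹) ^ (k + 1))) := by
  have hm : m ≠ 0 := by omega
  have hjc : (j : ℂ) ≠ 0 := by exact_mod_cast hj
  have key : ∀ k : ℕ, HasSum (fun n : ℤ => ((j : ℂ)⁻¹) ^ (N - k) * D k *
      ((((n : ℂ)⁻¹) ^ (k + 1) + (-1) ^ (k + 1) * (((n : ℂ) + j)⁻¹) ^ (k + 1)) -
        ((if n = 0 then (-1) ^ (k + 1) * ((j : ℂ)⁻¹) ^ (k + 1) else 0) +
         (if n = -j then (-1) ^ (k + 1) * ((j : ℂ)⁻¹) ^ (k + 1) else 0))))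
      (((j : ℂ)⁻¹) ^ (N - k) * D k *
        (2 * mzvSigma (k + 1) - 2 * (-1) ^ (k + 1) * ((j : ℂ)⁻¹) ^ (k + 1))) := by
    intro k
    apply HasSum.mul_left
    have a1 := (hasSum_ite_eq (0 : ℤ) ((-1) ^ (k + 1) * ((j : ℂ)⁻¹) ^ (k + 1))).add
      (hasSum_ite_eq (-j) ((-1) ^ (k + 1) * ((j : ℂ)⁻¹) ^ (k + 1)))
    rw [← two_mul, ← mul_assoc] at a1
    exact (mzv_pair k j).sub a1
  have := hasSum_sum (s := range (N + 1)) (fun k _ => key k)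
  refine this.congr_fun fun n => ?_
  by_cases h0 : n = 0
  · subst h0
    have : (0 : ℤ) ≠ -j := by omega
    rw [sum_eq_zero]
    · simp [hm]
    · intro k _
      simp [this]
  by_cases h1 : n = -j
  · subst h1
    rw [sum_eq_zero]
    · simp [hm]
    · intro k _
      rw [if_neg h0, if_pos rfl]
      push_cast
      rw [inv_neg, neg_pow (j : ℂ)⁻¹]
      simp
  · have hn : (n : ℂ) ≠ 0 := by exact_mod_cast h0
    have hnj : (n : ℂ) + j ≠ 0 := by
      have : n + j ≠ 0 := by omega
      exact_mod_cast this
    simp only [if_neg h0, if_neg h1, add_zero, sub_zero]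
    exact hD n j hn hjc hnj


/-- The lattice summand. -/
noncomputable def mzvF (m : ℕ) (q : ℤ × ℤ) : ℂ :=
  (((q.1 : ℂ) * q.2 * (q.1 + q.2))⁻¹) ^ m

/-- The lattice summand restricted to the positive quadrant. -/
noncomputable def mzvG (m : ℕ) (q : ℤ × ℤ) : ℂ :=
  if 0 < q.1 ∧ 0 < q.2 then mzvF m q else 0

lemma mzv_hasSum_nat (m : ℕ) (hm : 2 ≤ m) :
    HasSum (fun q : ℕ × ℕ => (((((q.1 : ℝ) + 1) * ((q.2 : ℝ) + 1) *
      ((q.1 : ℝ) + (q.2 : ℝ) + 2))⁻¹) ^ m)) (mzvS (m : ℤ)) := by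
  have h1 : Summable (fun n : ℕ => (((n : ℝ) + 1)⁻¹) ^ m) := by
    have := (summable_nat_add_iff 1).2 (Real.summable_one_div_nat_pow (p := m) |>.2
      (by omega))
    simpa using this
  have h2 := h1.mul_of_nonneg h1 (fun n => by positivity) (fun n => by positivity)
  have hs : Summable (fun q : ℕ × ℕ => (((((q.1 : ℝ) + 1) * ((q.2 : ℝ) + 1) *
      ((q.1 : ℝ) + (q.2 : ℝ) + 2))⁻¹) ^ m)) := by
    refine h2.of_nonneg_of_le (fun q => by positivity) (fun q => ?_)
    rw [← mul_pow, ← mul_inv]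
    refine pow_le_pow_left₀ (by positivity) (inv_anti₀ (by positivity) ?_) m
    have a : (0:ℝ) ≤ q.1 := Nat.cast_nonneg _
    have b : (0:ℝ) ≤ q.2 := Nat.cast_nonneg _
    exact le_mul_of_one_le_right (by positivity) (by linarith)
  have := hs.hasSum
  rw [hs.tsum_prod] at this
  convert this using 1
  unfold mzvS
  simp only [zpow_neg, zpow_natCast, inv_pow]

lemma mzv_hasSum_G (m : ℕ) (hm : 2 ≤ m) : HasSum (mzvG m) (mzvS (m : ℤ) : ℂ) := by
  have h := Complex.hasSum_ofReal.2 (mzv_hasSum_nat m hm)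
  let e : ℕ × ℕ → ℤ × ℤ := fun q => ((q.1 : ℤ) + 1, (q.2 : ℤ) + 1)
  have he : Function.Injective e := by
    rintro ⟨a, b⟩ ⟨c, d⟩ h
    simp only [e, Prod.mk.injEq] at h ⊢
    omega
  rw [← he.hasSum_iff]
  · refine h.congr_fun fun q => ?_
    have : (0 : ℤ) < (q.1 : ℤ) + 1 ∧ (0 : ℤ) < (q.2 : ℤ) + 1 := by omega
    simp only [Function.comp, e, mzvG, mzvF, this, and_self, if_true]
    push_cast
    congr 3
    ring
  · rintro ⟨a, b⟩ hq
    unfold mzvG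
    rw [if_neg]
    rintro ⟨ha, hb⟩
    apply hq
    simp only at ha hb
    refine ⟨((a - 1).toNat, (b - 1).toNat), ?_⟩
    simp only [e, Prod.mk.injEq]
    omega

lemma mzv_F_congr (m : ℕ) (hm : Even m) {a b c d : ℤ}
    (h : a * b * (a + b) = c * d * (c + d) ∨ a * b * (a + b) = -(c * d * (c + d))) :
    mzvF m (a, b) = mzvF m (c, d) := by
  unfold mzvF
  simp only
  rcases h with h | h
  · have : (a : ℂ) * b * (a + b) = c * d * (c + d) := by exact_mod_cast h
    rw [this]
  · have : (a : ℂ) * b * (a + b) = -(c * d * (c + d)) := by exact_mod_cast h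
    rw [this, inv_neg, hm.neg_pow]

lemma mzv_F_decomp (m : ℕ) (hm : Even m) (hm0 : m ≠ 0) (a b : ℤ) :
    mzvF m (a, b) = mzvG m (a, b) + mzvG m (-a, -b) + mzvG m (a, -a - b) + mzvG m (-a, a + b)
      + mzvG m (b, -a - b) + mzvG m (-b, a + b) := by
  have e1 : mzvF m (-a, -b) = mzvF m (a, b) := mzv_F_congr m hm (Or.inr (by ring))
  have e2 : mzvF m (a, -a - b) = mzvF m (a, b) := mzv_F_congr m hm (Or.inl (by ring))
  have e3 : mzvF m (-a, a + b) = mzvF m (a, b) := mzv_F_congr m hm (Or.inr (by ring))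
  have e4 : mzvF m (b, -a - b) = mzvF m (a, b) := mzv_F_congr m hm (Or.inl (by ring))
  have e5 : mzvF m (-b, a + b) = mzvF m (a, b) := mzv_F_congr m hm (Or.inr (by ring))
  simp only [mzvG, e1, e2, e3, e4, e5]
  by_cases hz : a * b * (a + b) = 0
  · have : mzvF m (a, b) = 0 := by
      unfold mzvF
      have : (a : ℂ) * b * (a + b) = 0 := by exact_mod_cast hz
      simp [this, hm0]
    simp [this]
  · have ha : a ≠ 0 := by rintro rfl; simp at hz
    have hb : b ≠ 0 := by rintro rfl; simp at hz
    have hc : a + b ≠ 0 := by intro h; simp [h] at hz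
    generalize mzvF m (a, b) = v
    rcases lt_or_gt_of_ne ha with ha | ha <;> rcases lt_or_gt_of_ne hb with hb | hb <;>
      rcases lt_or_gt_of_ne hc with hc | hc <;> split_ifs <;> first | omega | simp

lemma mzv_hasSum_F (m : ℕ) (hm : Even m) (hm2 : 2 ≤ m) :
    HasSum (mzvF m) (6 * (mzvS (m : ℤ) : ℂ)) := by
  have h := mzv_hasSum_G m hm2
  have inv : ∀ φ ψ : ℤ × ℤ → ℤ × ℤ, (∀ q, ψ (φ q) = q) → (∀ q, φ (ψ q) = q) →
      HasSum (fun q => mzvG m (φ q)) (mzvS (m : ℤ) : ℂ) := by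
    intro φ ψ h1 h2
    let e : (ℤ × ℤ) ≃ (ℤ × ℤ) := ⟨φ, ψ, h1, h2⟩
    have h3 : HasSum (mzvG m ∘ e) (mzvS (m : ℤ) : ℂ) := e.hasSum_iff.2 h
    exact h3
  have i1 := inv (fun q => (-q.1, -q.2)) (fun q => (-q.1, -q.2)) (by simp) (by simp)
  have i2 := inv (fun q => (q.1, -q.1 - q.2)) (fun q => (q.1, -q.1 - q.2)) (by simp) (by simp)
  have i3 := inv (fun q => (-q.1, q.1 + q.2)) (fun q => (-q.1, q.1 + q.2)) (by simp) (by simp)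
  have i4 := inv (fun q => (q.2, -q.1 - q.2)) (fun q => (-q.1 - q.2, q.1))
    (by intro q; apply Prod.ext <;> dsimp only <;> ring)
    (by intro q; apply Prod.ext <;> dsimp only <;> ring)
  have i5 := inv (fun q => (-q.2, q.1 + q.2)) (fun q => (q.1 + q.2, -q.1))
    (by intro q; apply Prod.ext <;> dsimp only <;> ring)
    (by intro q; apply Prod.ext <;> dsimp only <;> ring)
  have := ((((h.add i1).add i2).add i3).add i4).add i5
  convert this using 1
  · funext q
    exact mzv_F_decomp m hm (by omega) q.1 q.2
  · ring

lemma mzv_inner {r : ℝ} (h0 : 0 < r) (h1 : r < 1) (m N : ℕ) {D : ℕ → ℂ} (hD : ∀ x y : ℂ,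
    x ≠ 0 → y ≠ 0 → x + y ≠ 0 → (x⁻¹) ^ m * ((x + y)⁻¹) ^ m =
      ∑ k ∈ range (N + 1), (y⁻¹) ^ (N - k) * D k *
        ((x⁻¹) ^ (k + 1) + (-1) ^ (k + 1) * ((x + y)⁻¹) ^ (k + 1))) {y : ℂ} (hy : r < ‖y‖) :
    (∮ x in C(0, r), ((Real.pi : ℂ) * Complex.cot (Real.pi * x)) *
        ((x⁻¹) ^ m * ((x + y)⁻¹) ^ m)) =
      (2 * Real.pi * Complex.I) * ∑ k ∈ range (N + 1), (y⁻¹) ^ (N - k) * D k *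
        (-mzvSigma (k + 1) + (-1) ^ (k + 1) * (y⁻¹) ^ (k + 1)) := by
  have hx0 : ∀ x ∈ Metric.sphere (0:ℂ) r, x ≠ 0 := by
    rintro x hx rfl; simp at hx; linarith
  have hxy : ∀ x ∈ Metric.sphere (0:ℂ) r, x + y ≠ 0 := by
    intro x hx h
    rw [add_eq_zero_iff_eq_neg] at h
    subst h
    simp at hx; linarith
  have hy0 : y ≠ 0 := by rintro rfl; simp at hy; linarith
  have c0 := mzv_cot_continuousOn h0 h1
  have c1 : ContinuousOn (fun x : ℂ => x⁻¹) (Metric.sphere 0 r) := continuousOn_id.inv₀ hx0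
  have c2 : ContinuousOn (fun x : ℂ => (x + y)⁻¹) (Metric.sphere 0 r) :=
    (continuousOn_id.fun_add continuousOn_const).inv₀ hxy
  have i1 : ∀ k : ℕ, CircleIntegrable (fun x => ((Real.pi : ℂ) * Complex.cot (Real.pi * x)) *
      (x⁻¹) ^ (k + 1)) 0 r := fun k =>
    ContinuousOn.circleIntegrable h0.le (c0.fun_mul (c1.fun_pow _))
  have i2 : ∀ k : ℕ, CircleIntegrable (fun x => (-1) ^ (k + 1) *
      (((Real.pi : ℂ) * Complex.cot (Real.pi * x)) *
      ((x + y)⁻¹) ^ (k + 1))) 0 r := fun k =>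
    ContinuousOn.circleIntegrable h0.le (continuousOn_const.fun_mul (c0.fun_mul (c2.fun_pow _)))
  have e : (∮ x in C(0, r), ((Real.pi : ℂ) * Complex.cot (Real.pi * x)) *
        ((x⁻¹) ^ m * ((x + y)⁻¹) ^ m)) =
      ∮ x in C(0, r), ∑ k ∈ range (N + 1), ((y⁻¹) ^ (N - k) * D k) *
        (((Real.pi : ℂ) * Complex.cot (Real.pi * x)) * (x⁻¹) ^ (k + 1) + (-1) ^ (k + 1) *
          (((Real.pi : ℂ) * Complex.cot (Real.pi * x)) * ((x + y)⁻¹) ^ (k + 1))) := by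
    apply circleIntegral.integral_congr h0.le
    intro x hx
    simp only
    rw [hD x y (hx0 x hx) hy0 (hxy x hx), mul_sum]
    apply sum_congr rfl
    intro k _
    ring
  rw [e, circleIntegral.integral_fun_sum, mul_sum]
  · apply sum_congr rfl
    intro k _
    rw [circleIntegral.integral_const_mul, circleIntegral.integral_add (i1 k) (i2 k),
      circleIntegral.integral_const_mul, mzv_cot_pow h0 h1, mzv_cot_shift h0 h1 hy]
    ring
  · intro k _
    exact ((i1 k).add (i2 k)).const_smul (a := (y⁻¹) ^ (N - k) * D k)

lemma mzv_outer {r : ℝ} (h0 : 0 < r) (h1 : r < 1) (m N : ℕ) (hm : 1 ≤ m) (D : ℕ → ℂ) :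
    (∮ y in C(0, r), ((Real.pi : ℂ) * Complex.cot (Real.pi * y)) *
      ((y⁻¹) ^ m * ∑ k ∈ range (N + 1), (y⁻¹) ^ (N - k) * D k *
        (-mzvSigma (k + 1) + (-1) ^ (k + 1) * (y⁻¹) ^ (k + 1)))) =
      (2 * Real.pi * Complex.I) * ∑ k ∈ range (N + 1), D k *
        (mzvSigma (k + 1) * mzvSigma (m + (N - k)) -
          (-1) ^ (k + 1) * mzvSigma (m + (N - k) + (k + 1))) := by
  have hx0 : ∀ x ∈ Metric.sphere (0:ℂ) r, x ≠ 0 := by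
    rintro x hx rfl; simp at hx; linarith
  have c0 := mzv_cot_continuousOn h0 h1
  have c1 : ContinuousOn (fun x : ℂ => x⁻¹) (Metric.sphere 0 r) := continuousOn_id.inv₀ hx0
  have i1 : ∀ (c : ℂ) (p : ℕ), CircleIntegrable (fun x =>
      c * (((Real.pi : ℂ) * Complex.cot (Real.pi * x)) * (x⁻¹) ^ p)) 0 r := fun c p =>
    ContinuousOn.circleIntegrable h0.le (continuousOn_const.fun_mul (c0.fun_mul (c1.fun_pow _)))
  have cp : ∀ p : ℕ, 1 ≤ p →
      (∮ x in C(0, r), ((Real.pi : ℂ) * Complex.cot (Real.pi * x)) * (x⁻¹) ^ p) =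
      -(2 * Real.pi * Complex.I) * mzvSigma p := by
    intro p hp
    obtain ⟨q, rfl⟩ : ∃ q, p = q + 1 := ⟨p - 1, by omega⟩
    exact mzv_cot_pow h0 h1 q
  have e : (∮ y in C(0, r), ((Real.pi : ℂ) * Complex.cot (Real.pi * y)) *
      ((y⁻¹) ^ m * ∑ k ∈ range (N + 1), (y⁻¹) ^ (N - k) * D k *
        (-mzvSigma (k + 1) + (-1) ^ (k + 1) * (y⁻¹) ^ (k + 1)))) =
      ∮ y in C(0, r), ∑ k ∈ range (N + 1),
        ((D k * -mzvSigma (k + 1)) *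
          (((Real.pi : ℂ) * Complex.cot (Real.pi * y)) * (y⁻¹) ^ (m + (N - k))) +
        (D k * (-1) ^ (k + 1)) *
          (((Real.pi : ℂ) * Complex.cot (Real.pi * y)) * (y⁻¹) ^ (m + (N - k) + (k + 1)))) := by
    congr 1
    funext y
    rw [mul_sum, mul_sum]
    apply sum_congr rfl
    intro k _
    simp only [pow_add]
    ring
  rw [e, circleIntegral.integral_fun_sum, mul_sum]
  · apply sum_congr rfl
    intro k _
    rw [circleIntegral.integral_add (i1 _ _) (i1 _ _),
      circleIntegral.integral_const_mul, circleIntegral.integral_const_mul,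
      cp _ (by omega), cp _ (by omega)]
    ring
  · intro k _
    exact (i1 _ _).add (i1 _ _)

lemma mzv_lattice (m N : ℕ) (hm : Even m) (hm2 : 2 ≤ m) (hN : m + m = N + 1) {D : ℕ → ℂ}
    (hD : ∀ x y : ℂ, x ≠ 0 → y ≠ 0 → x + y ≠ 0 → (x⁻¹) ^ m * ((x + y)⁻¹) ^ m =
      ∑ k ∈ range (N + 1), (y⁻¹) ^ (N - k) * D k *
        ((x⁻¹) ^ (k + 1) + (-1) ^ (k + 1) * ((x + y)⁻¹) ^ (k + 1))) :
    6 * (mzvS (m : ℤ) : ℂ) = 2 * ∑ k ∈ range (N + 1), D k *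
        (mzvSigma (k + 1) * mzvSigma (m + (N - k)) -
          (-1) ^ (k + 1) * mzvSigma (m + (N - k) + (k + 1))) := by
  have hm0 : m ≠ 0 := by omega
  have h1 : HasSum (fun j : ℤ => ((j : ℂ)⁻¹) ^ m *
      (∑ k ∈ range (N + 1), ((j : ℂ)⁻¹) ^ (N - k) * D k *
        (2 * mzvSigma (k + 1) - 2 * (-1) ^ (k + 1) * ((j : ℂ)⁻¹) ^ (k + 1))))
      (6 * (mzvS (m : ℤ) : ℂ)) := by
    refine (mzv_hasSum_F m hm hm2).prod_fiberwise fun j => ?_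
    rcases eq_or_ne j 0 with rfl | hj
    · simp [mzvF, hm0]
    · refine ((mzv_T m N hN hD j hj).mul_left (((j : ℂ)⁻¹) ^ m)).congr_fun fun n => ?_
      simp only [mzvF, ← mul_pow, ← mul_inv]
      congr 2
      ring
  refine h1.unique ?_
  rw [mul_sum]
  have h2 := hasSum_sum (s := range (N + 1)) (fun k _ =>
    (((mzv_hasSum_sigma (m + (N - k)) (by omega)).mul_left (2 * D k * mzvSigma (k + 1))).sub
      ((mzv_hasSum_sigma (m + (N - k) + (k + 1)) (by omega)).mul_left
        (2 * D k * (-1) ^ (k + 1)))))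
  have e1 : ∀ j : ℤ, ((j : ℂ)⁻¹) ^ m *
      (∑ k ∈ range (N + 1), ((j : ℂ)⁻¹) ^ (N - k) * D k *
        (2 * mzvSigma (k + 1) - 2 * (-1) ^ (k + 1) * ((j : ℂ)⁻¹) ^ (k + 1))) =
      ∑ k ∈ range (N + 1), (2 * D k * mzvSigma (k + 1) * ((j : ℂ)⁻¹) ^ (m + (N - k)) -
        2 * D k * (-1) ^ (k + 1) * ((j : ℂ)⁻¹) ^ (m + (N - k) + (k + 1))) := by
    intro j
    rw [mul_sum]
    apply sum_congr rfl
    intro k _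
    simp only [pow_add]
    ring
  have e2 : ∑ k ∈ range (N + 1), 2 * (D k *
        (mzvSigma (k + 1) * mzvSigma (m + (N - k)) -
          (-1) ^ (k + 1) * mzvSigma (m + (N - k) + (k + 1)))) =
      ∑ k ∈ range (N + 1), (2 * D k * mzvSigma (k + 1) * mzvSigma (m + (N - k)) -
        2 * D k * (-1) ^ (k + 1) * mzvSigma (m + (N - k) + (k + 1))) := by
    apply sum_congr rfl
    intro k _
    ring
  rw [e2]
  exact h2.congr_fun e1

theorem mzvS_residue_formula (g : ℤ) (hg : 1 ≤ g)
    (r₁ r₂ : ℝ) (hr₁0 : 0 < r₁) (hr₁₂ : r₁ < r₂) (hr₂1 : r₂ < 1) :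
    (mzvS (2 * g) : ℂ) =
      (1 / 3) * (2 * (Real.pi : ℂ) * Complex.I) ^ (-2 : ℤ) *
        ∮ y in C(0, r₂), ∮ x in C(0, r₁),
          (Real.pi : ℂ) ^ 2 * Complex.cot ((Real.pi : ℂ) * x) *
            Complex.cot ((Real.pi : ℂ) * y) * (x * y * (x + y)) ^ (-2 * g) := by
  obtain ⟨G, rfl⟩ : ∃ G : ℕ, g = G := ⟨g.toNat, by omega⟩
  have hG : 1 ≤ G := by exact_mod_cast hg
  obtain ⟨m, hm⟩ : ∃ m : ℕ, m = 2 * G := ⟨_, rfl⟩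
  obtain ⟨N, hN⟩ : ∃ N : ℕ, m + m = N + 1 := ⟨m + m - 1, by omega⟩
  have hev : Even m := ⟨G, by omega⟩
  obtain ⟨D, hD⟩ := mzv_pf_symm m N hev hN
  have hlat := mzv_lattice m N hev (by omega) hN hD
  have hr₂0 : 0 < r₂ := hr₁0.trans hr₁₂
  have hr₁1 : r₁ < 1 := hr₁₂.trans hr₂1
  have hout := mzv_outer hr₂0 hr₂1 m N (by omega) D
  have hc : (2 * (G : ℤ)) = (m : ℤ) := by omega
  have hc' : (-2 * (G : ℤ)) = -(m : ℤ) := by omega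
  rw [hc, hc']
  have e : (∮ y in C(0, r₂), ∮ x in C(0, r₁),
          (Real.pi : ℂ) ^ 2 * Complex.cot ((Real.pi : ℂ) * x) *
            Complex.cot ((Real.pi : ℂ) * y) * (x * y * (x + y)) ^ (-(m : ℤ))) =
      ∮ y in C(0, r₂), (2 * Real.pi * Complex.I) *
        (((Real.pi : ℂ) * Complex.cot (Real.pi * y)) *
        ((y⁻¹) ^ m * ∑ k ∈ range (N + 1), (y⁻¹) ^ (N - k) * D k *
        (-mzvSigma (k + 1) + (-1) ^ (k + 1) * (y⁻¹) ^ (k + 1)))) := by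
    apply circleIntegral.integral_congr hr₂0.le
    intro y hy
    have hy' : r₁ < ‖y‖ := by
      have : ‖y‖ = r₂ := by simpa using hy
      linarith
    have hin := mzv_inner hr₁0 hr₁1 m N hD hy'
    simp only
    have e1 : ∀ x : ℂ, (Real.pi : ℂ) ^ 2 * Complex.cot ((Real.pi : ℂ) * x) *
            Complex.cot ((Real.pi : ℂ) * y) * (x * y * (x + y)) ^ (-(m : ℤ)) =
        (((Real.pi : ℂ) * Complex.cot (Real.pi * y)) * (y⁻¹) ^ m) *
        (((Real.pi : ℂ) * Complex.cot (Real.pi * x)) * ((x⁻¹) ^ m * ((x + y)⁻¹) ^ m)) := by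
      intro x
      rw [zpow_neg, zpow_natCast, mul_pow, mul_pow, mul_inv, mul_inv]
      simp only [inv_pow]
      ring
    simp only [e1]
    rw [circleIntegral.integral_const_mul, hin]
    ring
  rw [e, circleIntegral.integral_const_mul, hout]
  have hpi : (Real.pi : ℂ) ≠ 0 := by exact_mod_cast Real.pi_ne_zero
  have hne : (2 * (Real.pi : ℂ) * Complex.I) ≠ 0 := by
    simp [hpi]
  have hz : (2 * (Real.pi : ℂ) * Complex.I) ^ (-2 : ℤ) *
      ((2 * (Real.pi : ℂ) * Complex.I) * (2 * (Real.pi : ℂ) * Complex.I)) = 1 := by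
    rw [zpow_neg, ← pow_two]
    exact inv_mul_cancel₀ (pow_ne_zero 2 hne)
  generalize (2 * (Real.pi : ℂ) * Complex.I) ^ (-2 : ℤ) = w at hz
  generalize (2 * (Real.pi : ℂ) * Complex.I) = t at hz
  generalize (∑ k ∈ range (N + 1), D k *
        (mzvSigma (k + 1) * mzvSigma (m + (N - k)) -
          (-1) ^ (k + 1) * mzvSigma (m + (N - k) + (k + 1)))) = X at hlat
  linear_combination (1 / 6 : ℂ) * hlat - (1 / 3 : ℂ) * X * hz
end
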